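/- arXiv:2202.08775 — 6 statements merged into one kernel-verified Lean document; each statement's English description precedes it below -/
import Mathlib

section
/- Let s ≥ 2 be an integer, let I ⊆ ℝ be an open interval containing 0, and let r : I → ℝ be a C^∞ function with r(x) ≠ 0 for all x ∈ I. Define f(x) = r(x)·x^{s−1}. Then the function x ↦ ((f'(x))² − f(x)·f''(x)) / (2 f(x)²) tends to +∞ as x → 0 along nonzero x. -/
open Filter Topology

/-- Let `s ≥ 2`, let `I ⊆ ℝ` be an open interval containing `0`, and let
`r : I → ℝ` be `C^∞` with `r x ≠ 0` on `I`. Define `f x = r x * x ^ (s−1)`. Then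
`x ↦ ((f'(x))² − f(x)·f''(x)) / (2 f(x)²)` tends to `+∞` as `x → 0` along nonzero `x`. -/
theorem statement4 (s : ℕ) (hs : 2 ≤ s) (I : Set ℝ) (hIopen : IsOpen I)
    (hIconn : I.OrdConnected) (h0I : (0 : ℝ) ∈ I)
    (r : ℝ → ℝ) (hr : ContDiffOn ℝ (⊤ : ℕ∞) r I) (hrne : ∀ x ∈ I, r x ≠ 0)
    (f : ℝ → ℝ) (hf : ∀ x, f x = r x * x ^ (s - 1)) :
    Tendsto
      (fun x : ℝ => ((deriv f x) ^ 2 - f x * deriv (deriv f) x) / (2 * (f x) ^ 2))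
      (𝓝[≠] (0 : ℝ)) atTop := by
  obtain ⟨m, rfl⟩ : ∃ m, s = m + 2 := ⟨s - 2, by omega⟩
  have hsub : m + 2 - 1 = m + 1 := by omega
  rw [hsub] at hf
  have hr1 : ContDiffOn ℝ (⊤ : ℕ∞) (deriv r) I := hr.deriv_of_isOpen hIopen (by simp)
  have hr2 : ContDiffOn ℝ (⊤ : ℕ∞) (deriv (deriv r)) I := hr1.deriv_of_isOpen hIopen (by simp)
  have hd : ∀ x ∈ I, HasDerivAt r (deriv r x) x := fun x hx =>
    (((hr.differentiableOn (by simp)) x hx).differentiableAt (hIopen.mem_nhds hx)).hasDerivAt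
  have hd1 : ∀ x ∈ I, HasDerivAt (deriv r) (deriv (deriv r) x) x := fun x hx =>
    (((hr1.differentiableOn (by simp)) x hx).differentiableAt (hIopen.mem_nhds hx)).hasDerivAt
  have hfe : f = fun x => r x * x ^ (m + 1) := funext hf
  have hf1 : ∀ x ∈ I, deriv f x = deriv r x * x ^ (m + 1) + r x * ((m + 1) * x ^ m) := by
    intro x hx
    rw [hfe]
    have h := ((hd x hx).fun_mul (hasDerivAt_pow (m + 1) x)).deriv
    simpa using h
  have hf2 : ∀ x ∈ I, deriv (deriv f) x =
      deriv (deriv r) x * x ^ (m + 1) + deriv r x * ((m + 1) * x ^ m)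
      + (deriv r x * ((m + 1) * x ^ m) + r x * ((m + 1) * (m * x ^ (m - 1)))) := by
    intro x hx
    have he : deriv f =ᶠ[𝓝 x]
        fun x => deriv r x * x ^ (m + 1) + r x * (((m : ℝ) + 1) * x ^ m) := by
      filter_upwards [hIopen.mem_nhds hx] with y hy using hf1 y hy
    rw [he.deriv_eq]
    have h := (((hd1 x hx).fun_mul (hasDerivAt_pow (m + 1) x)).fun_add
      ((hd x hx).fun_mul ((hasDerivAt_pow m x).const_mul ((m : ℝ) + 1)))).deriv
    simpa using h
  have hc : ContinuousAt
      (fun x => ((deriv r x) ^ 2 - r x * deriv (deriv r) x) / (2 * (r x) ^ 2)) 0 := by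
    have hI := hIopen.mem_nhds h0I
    have c0 := hr.continuousOn.continuousAt hI
    have c1 := hr1.continuousOn.continuousAt hI
    have c2 := hr2.continuousOn.continuousAt hI
    have := hrne 0 h0I
    exact ContinuousAt.div ((c1.pow 2).sub (c0.mul c2)) (continuousAt_const.mul (c0.pow 2))
      (by positivity)
  have ht : Tendsto (fun x : ℝ => (((m : ℝ) + 1) / 2) * (x ^ 2)⁻¹) (𝓝[≠] (0 : ℝ)) atTop := by
    apply Tendsto.const_mul_atTop (by positivity)
    apply Tendsto.inv_tendsto_nhdsGT_zero
    rw [tendsto_nhdsWithin_iff]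
    constructor
    · have : Tendsto (fun x : ℝ => x ^ 2) (𝓝 0) (𝓝 (0 ^ 2)) := (continuous_pow 2).tendsto 0
      simp only [ne_eq, OfNat.ofNat_ne_zero, not_false_eq_true, zero_pow] at this
      exact this.mono_left nhdsWithin_le_nhds
    · filter_upwards [self_mem_nhdsWithin] with x hx
      have : x ≠ 0 := hx
      exact Set.mem_Ioi.2 (by positivity)
  refine (Tendsto.add_atTop (hc.tendsto.mono_left nhdsWithin_le_nhds) ht).congr' ?_
  filter_upwards [self_mem_nhdsWithin, mem_nhdsWithin_of_mem_nhds (hIopen.mem_nhds h0I)]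
    with x hx hxI
  have hx0 : x ≠ 0 := hx
  have hrx := hrne x hxI
  rw [hf1 x hxI, hf2 x hxI, hf x]
  rcases m with _ | k
  · simp
    field_simp
    ring
  · simp only [Nat.add_sub_cancel]
    push_cast
    field_simp
    ring
end

section
/- Let s ≥ 2 be an integer, let I ⊆ ℝ be an open interval containing 0, let r : I → ℝ be a C^∞ function with r(x) ≠ 0 for all x ∈ I, and set f(x) = r(x)·x^{s−1}. Let C₁, C₂ ≥ 0 and let u : I ∖ {0} → ℝ satisfy |u(x)| ≤ C₁ + C₂·|f'(x)/f(x)| for all x ∈ I ∖ {0}. Then the function x ↦ ((f'(x))² − f(x)·f''(x)) / (2 f(x)²) + u(x) tends to +∞ as x → 0 along nonzero x. In particular, for every K ∈ ℝ there exists δ > 0 such that this function is strictly greater than −K for all 0 < |x| < δ. -/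
open Filter Topology

/-- Let `s ≥ 2`, let `I ⊆ ℝ` be an open interval containing `0`, let
`r : I → ℝ` be `C^∞` with `r x ≠ 0` on `I`, and set `f x = r x * x ^ (s−1)`. Let
`C₁, C₂ ≥ 0` and let `u : I ∖ {0} → ℝ` satisfy `|u x| ≤ C₁ + C₂·|f'(x)/f(x)|` on `I ∖ {0}`.
Then `x ↦ ((f'(x))² − f(x)·f''(x)) / (2 f(x)²) + u x` tends to `+∞` as `x → 0` along
nonzero `x`. In particular, for every `K ∈ ℝ` there is `δ > 0` such that this function is
strictly greater than `−K` for all `0 < |x| < δ`. -/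
theorem statement5 (s : ℕ) (hs : 2 ≤ s) (I : Set ℝ) (hIopen : IsOpen I)
    (hIconn : I.OrdConnected) (h0I : (0 : ℝ) ∈ I)
    (r : ℝ → ℝ) (hr : ContDiffOn ℝ (⊤ : ℕ∞) r I) (hrne : ∀ x ∈ I, r x ≠ 0)
    (f : ℝ → ℝ) (hf : ∀ x, f x = r x * x ^ (s - 1))
    (C₁ C₂ : ℝ) (hC₁ : 0 ≤ C₁) (hC₂ : 0 ≤ C₂)
    (u : ℝ → ℝ)
    (hu : ∀ x ∈ I, x ≠ 0 → |u x| ≤ C₁ + C₂ * |deriv f x / f x|) :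
    Tendsto
        (fun x : ℝ =>
          ((deriv f x) ^ 2 - f x * deriv (deriv f) x) / (2 * (f x) ^ 2) + u x)
        (𝓝[≠] (0 : ℝ)) atTop ∧
      ∀ K : ℝ, ∃ δ > (0 : ℝ), ∀ x : ℝ, 0 < |x| → |x| < δ →
        ((deriv f x) ^ 2 - f x * deriv (deriv f) x) / (2 * (f x) ^ 2) + u x > -K := by
  have hn : 1 ≤ s - 1 := by omega
  generalize s - 1 = n at hf hn
  have hn' : (0 : ℝ) < n := by exact_mod_cast hn
  have hdr : ∀ x ∈ I, HasDerivAt r (deriv r x) x := fun x hx =>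
    ((hr.differentiableOn (by simp)).differentiableAt (hIopen.mem_nhds hx)).hasDerivAt
  have hr1 : ContDiffOn ℝ 1 (deriv r) I :=
    hr.deriv_of_isOpen hIopen (by norm_cast)
  set q : ℝ → ℝ := fun x => deriv r x / r x with hq
  have hqc : ContDiffOn ℝ 1 q I :=
    hr1.div (hr.of_le (by norm_cast)) hrne
  have hdq : ∀ x ∈ I, HasDerivAt q (deriv q x) x := fun x hx =>
    ((hqc.differentiableOn (by simp)).differentiableAt (hIopen.mem_nhds hx)).hasDerivAt
  have hq0 : ContinuousAt q 0 := (hdq 0 h0I).continuousAt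
  have hq1 : ContinuousAt (deriv q) 0 :=
    (hqc.continuousOn_deriv_of_isOpen hIopen le_rfl).continuousAt (hIopen.mem_nhds h0I)
  have hfne : ∀ x ∈ I, x ≠ 0 → f x ≠ 0 := fun x hx h0 => by
    rw [hf]; exact mul_ne_zero (hrne x hx) (pow_ne_zero _ h0)
  have hdf : ∀ x ∈ I, x ≠ 0 → HasDerivAt f (f x * (q x + n / x)) x := fun x hx h0 => by
    have h := (hdr x hx).mul (hasDerivAt_pow n x)
    have e : f = r * fun x => x ^ n := by funext y; simp [hf]
    have hrx := hrne x hx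
    rw [← e] at h
    refine h.congr_deriv ?_
    rw [hf, hq]
    obtain ⟨m, rfl⟩ : ∃ m, n = m + 1 := ⟨n - 1, by omega⟩
    simp only [Nat.add_sub_cancel]
    field_simp
    ring
  have hddf : ∀ x ∈ I, x ≠ 0 → deriv (deriv f) x =
      f x * (q x + n / x) ^ 2 + f x * (deriv q x - n / x ^ 2) := fun x hx h0 => by
    have hev : deriv f =ᶠ[𝓝 x] fun y => f y * (q y + n * y⁻¹) := by
      filter_upwards [hIopen.mem_nhds hx, isOpen_ne.mem_nhds h0] with y hy hy0
      rw [(hdf y hy hy0).deriv, div_eq_mul_inv]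
    rw [hev.deriv_eq]
    have h := (hdf x hx h0).fun_mul ((hdq x hx).fun_add ((hasDerivAt_inv h0).const_mul (n : ℝ)))
    rw [h.deriv]
    field_simp
    ring
  have hmain : Tendsto (fun x : ℝ =>
      ((deriv f x) ^ 2 - f x * deriv (deriv f) x) / (2 * (f x) ^ 2) + u x)
      (𝓝[≠] (0 : ℝ)) atTop := by
    obtain ⟨M, hM⟩ : ∃ M, |q 0| < M ∧ |deriv q 0| < M :=
      ⟨max |q 0| |deriv q 0| + 1, by
        constructor
        · linarith [le_max_left |q 0| |deriv q 0|]
        · linarith [le_max_right |q 0| |deriv q 0|]⟩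
    have ht : Tendsto (fun x : ℝ => |x|⁻¹) (𝓝[≠] (0 : ℝ)) atTop := by
      simpa using tendsto_norm_inv_nhdsNE_zero_atTop (α := ℝ)
    have hp : Tendsto (fun t : ℝ => t * (n / 2 * t - C₂ * n) - (M / 2 + C₁ + C₂ * M))
        atTop atTop := by
      simp only [sub_eq_add_neg]
      apply tendsto_atTop_add_const_right
      apply tendsto_id.atTop_mul_atTop₀
      apply tendsto_atTop_add_const_right
      exact tendsto_id.const_mul_atTop (by positivity)
    refine tendsto_atTop_mono' _ ?_ (hp.comp ht)
    filter_upwards [nhdsWithin_le_nhds (hIopen.mem_nhds h0I), self_mem_nhdsWithin,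
      nhdsWithin_le_nhds (hq0.abs.eventually_lt_const hM.1),
      nhdsWithin_le_nhds (hq1.abs.eventually_lt_const hM.2)] with x hx h0 h1 h2
    have h0 : x ≠ 0 := h0
    have hfx := hfne x hx h0
    have hux := hu x hx h0
    rw [hddf x hx h0, (hdf x hx h0).deriv]
    rw [(hdf x hx h0).deriv, mul_div_cancel_left₀ _ hfx] at hux
    have e : ((f x * (q x + n / x)) ^ 2 - f x * (f x * (q x + n / x) ^ 2 +
        f x * (deriv q x - n / x ^ 2))) / (2 * f x ^ 2) = n / 2 * (|x|⁻¹) ^ 2 - deriv q x / 2 := by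
      rw [inv_pow, sq_abs]
      field_simp
      ring
    rw [e]
    have h3 : |q x + n / x| ≤ M + n * |x|⁻¹ := by
      refine (abs_add_le _ _).trans ?_
      rw [abs_div (n : ℝ) x, Nat.abs_cast, div_eq_mul_inv]
      linarith
    have h4 := mul_le_mul_of_nonneg_left h3 hC₂
    have h5 := (abs_le.1 hux).1
    have h6 := (abs_lt.1 h2).2
    simp only [Function.comp]
    linarith
  refine ⟨hmain, fun K => ?_⟩
  have h := hmain.eventually_gt_atTop (-K)
  rw [eventually_nhdsWithin_iff, Metric.eventually_nhds_iff] at h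
  obtain ⟨δ, hδ, h⟩ := h
  refine ⟨δ, hδ, fun x hx hxd => h (by simpa using hxd) (abs_pos.1 hx)⟩
end

section
/- Let n ≥ 1, let U ⊆ ℝ^{1+n} be open with coordinates (x, z₁, …, zₙ), and let A : U → Mₙ(ℝ) be a C^∞ matrix-valued map with entries a_{ij}. For q ∈ U define α_i(q) = Σ_{k=1}^n a_{ki}(q)·a_{kn}(q) and β(q) = √(Σ_{k=1}^n a_{kn}(q)²). Let q₀ ∈ U with β(q₀) ≠ 0, and let (x, z, p_x, p_z) : J → ℝ × ℝⁿ × ℝ × ℝⁿ be a C^∞ solution on an open interval J containing 0 of the Hamiltonian system x' = p_x, z' = (AᵀA)(x,z)·p_z, p_x' = −½·⟨p_z, ∂ₓ(AᵀA)(x,z)·p_z⟩, (p_z)'_j = −½·⟨p_z, ∂_{z_j}(AᵀA)(x,z)·p_z⟩ for j = 1,…,n, with initial data (x(0), z(0)) = q₀, p_x(0) = 0, and p_z(0) = eₙ/β(q₀) where eₙ is the n-th standard basis vector. Then x'(0) = 0, z_i'(0) = α_i(q₀)/β(q₀) for every i = 1,…,n, and x''(0) = −∂ₓβ(q₀)/β(q₀).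 -/
open scoped Matrix

/-- Let `n ≥ 1`, let `U ⊆ ℝ^{1+n}` be open with coordinates `(x, z)`, and
let `A : U → Mₙ(ℝ)` be a `C^∞` matrix-valued map with entries `a_{ij}`. For `q ∈ U` set
`αᵢ(q) = Σₖ a_{ki}(q)·a_{kn}(q)` and `β(q) = √(Σₖ a_{kn}(q)²)` (where `n` stands for the
last index). Let `q₀ ∈ U` with `β(q₀) ≠ 0`, and let `(x, z, pₓ, p_z)` be a `C^∞` solution
on an open interval `J ∋ 0` of the Hamiltonian system
`x' = pₓ`, `z' = (AᵀA)(x,z)·p_z`, `pₓ' = −½⟨p_z, ∂ₓ(AᵀA)·p_z⟩`,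
`(p_z)ⱼ' = −½⟨p_z, ∂_{zⱼ}(AᵀA)·p_z⟩`, with `(x(0),z(0)) = q₀`, `pₓ(0) = 0` and
`p_z(0) = eₙ/β(q₀)`. Then `x'(0) = 0`, `zᵢ'(0) = αᵢ(q₀)/β(q₀)` for every `i`, and
`x''(0) = −∂ₓβ(q₀)/β(q₀)`. -/
theorem statement9 (n : ℕ) (hn : 1 ≤ n)
    (U : Set (ℝ × (Fin n → ℝ))) (hUopen : IsOpen U)
    (a : ℝ → (Fin n → ℝ) → Matrix (Fin n) (Fin n) ℝ)
    (ha : ∀ i j, ContDiffOn ℝ (⊤ : ℕ∞) (fun q : ℝ × (Fin n → ℝ) => a q.1 q.2 i j) U)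
    (last : Fin n) (hlast : (last : ℕ) = n - 1)
    (α : ℝ → (Fin n → ℝ) → Fin n → ℝ)
    (hα : ∀ x z i, α x z i = ∑ k, a x z k i * a x z k last)
    (β : ℝ → (Fin n → ℝ) → ℝ)
    (hβ : ∀ x z, β x z = Real.sqrt (∑ k, (a x z k last) ^ 2))
    (q₀ : ℝ × (Fin n → ℝ)) (hq₀U : q₀ ∈ U) (hβq₀ : β q₀.1 q₀.2 ≠ 0)
    (M : ℝ → (Fin n → ℝ) → Matrix (Fin n) (Fin n) ℝ)
    (hM : ∀ x z, M x z = (a x z)ᵀ * a x z)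
    (J : Set ℝ) (hJopen : IsOpen J) (hJconn : J.OrdConnected) (h0J : (0 : ℝ) ∈ J)
    (x : ℝ → ℝ) (z : ℝ → Fin n → ℝ) (px : ℝ → ℝ) (pz : ℝ → Fin n → ℝ)
    (hx : ContDiffOn ℝ (⊤ : ℕ∞) x J) (hz : ContDiffOn ℝ (⊤ : ℕ∞) z J)
    (hpx : ContDiffOn ℝ (⊤ : ℕ∞) px J) (hpz : ContDiffOn ℝ (⊤ : ℕ∞) pz J)
    (hmem : ∀ t ∈ J, (x t, z t) ∈ U)
    (hode₁ : ∀ t ∈ J, deriv x t = px t)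
    (hode₂ : ∀ t ∈ J, ∀ i, deriv (fun s => z s i) t = (M (x t) (z t) *ᵥ pz t) i)
    (hode₃ : ∀ t ∈ J, deriv px t =
      -(1 / 2) * (pz t ⬝ᵥ
        ((Matrix.of fun i j => deriv (fun w => M w (z t) i j) (x t)) *ᵥ pz t)))
    (hode₄ : ∀ t ∈ J, ∀ j, deriv (fun s => pz s j) t =
      -(1 / 2) * (pz t ⬝ᵥ
        ((Matrix.of fun i k =>
            deriv (fun w => M (x t) (Function.update (z t) j w) i k) (z t j)) *ᵥ pz t)))
    (hx0 : x 0 = q₀.1) (hz0 : z 0 = q₀.2) (hpx0 : px 0 = 0)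
    (hpz0 : pz 0 = Pi.single last (1 / β q₀.1 q₀.2)) :
    deriv x 0 = 0 ∧
      (∀ i, deriv (fun s => z s i) 0 = α q₀.1 q₀.2 i / β q₀.1 q₀.2) ∧
      deriv (deriv x) 0 = -(deriv (fun w => β w q₀.2) q₀.1) / β q₀.1 q₀.2 := by
  have h1 : deriv x 0 = 0 := by rw [hode₁ 0 h0J, hpx0]
  refine ⟨h1, ?_, ?_⟩
  · intro i
    rw [hode₂ 0 h0J i, hx0, hz0, hpz0, Matrix.mulVec_single, hM, hα]
    simp [Matrix.mul_apply, div_eq_mul_inv, mul_comm]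
  · have hev : deriv x =ᶠ[nhds 0] px := by
      filter_upwards [hJopen.mem_nhds h0J] with t ht using hode₁ t ht
    have hS : ∀ w, M w q₀.2 last last = ∑ k, (a w q₀.2 k last) ^ 2 := by
      intro w
      simp [hM, Matrix.mul_apply, sq]
    have hdiff : DifferentiableAt ℝ (fun w => ∑ k, (a w q₀.2 k last) ^ 2) q₀.1 := by
      apply DifferentiableAt.fun_sum
      intro k _
      apply DifferentiableAt.pow
      have h2 : DifferentiableAt ℝ (fun q : ℝ × (Fin n → ℝ) => a q.1 q.2 k last)
          ((fun w : ℝ => (w, q₀.2)) q₀.1) :=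
        ((ha k last).contDiffAt (hUopen.mem_nhds hq₀U)).differentiableAt (by simp)
      have h3 : DifferentiableAt ℝ (fun w : ℝ => (w, q₀.2)) q₀.1 := by fun_prop
      exact h2.comp q₀.1 h3
    have hne : (∑ k, (a q₀.1 q₀.2 k last) ^ 2) ≠ 0 := by
      intro h
      apply hβq₀
      rw [hβ, h, Real.sqrt_zero]
    have hdβ : deriv (fun w => β w q₀.2) q₀.1 =
        deriv (fun w => ∑ k, (a w q₀.2 k last) ^ 2) q₀.1 / (2 * β q₀.1 q₀.2) := by
      simp only [hβ]
      exact (hdiff.hasDerivAt.sqrt hne).deriv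
    rw [hev.deriv_eq, hode₃ 0 h0J, hx0, hz0, hpz0, Matrix.mulVec_single, hdβ]
    simp only [single_dotProduct]
    simp only [Pi.smul_apply, Matrix.col_apply, Matrix.of_apply, hS, MulOpposite.smul_eq_mul_unop,
      MulOpposite.unop_op]
    field_simp
end

section
/- Let n ≥ 1, let U ⊆ ℝ^{1+n} be open with coordinates (x, z₁, …, zₙ), and let A : U → Mₙ(ℝ) be a C^∞ matrix-valued map with entries a_{ij}. For q ∈ U define α_i(q) = Σ_{k=1}^n a_{ki}(q)·a_{kn}(q) and β(q)² = Σ_{k=1}^n a_{kn}(q)². Let q₀ ∈ U with β(q₀) ≠ 0, and let (x, z, p_x, p_z) : J → ℝ × ℝⁿ × ℝ × ℝⁿ be a C^∞ solution on an open interval J containing 0 of the Hamiltonian system x' = p_x, z' = (AᵀA)(x,z)·p_z, p_x' = −½·⟨p_z, ∂ₓ(AᵀA)(x,z)·p_z⟩, (p_z)'_j = −½·⟨p_z, ∂_{z_j}(AᵀA)(x,z)·p_z⟩, with (x(0), z(0)) = q₀, p_x(0) = 0, and p_z(0) = eₙ/β(q₀). Then for every i = 1,…,n the second derivative z_i''(0)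 equals (1/β(q₀)²)·[ Σ_{l=1}^n ∂_{z_l}α_i(q₀)·α_l(q₀) − ½·Σ_{j,k=1}^n a_{ki}(q₀)·a_{kj}(q₀)·∂_{z_j}(β²)(q₀) ]. -/
open scoped Matrix

theorem hasDerivAt_update_aux {n : ℕ} (g : ℝ × (Fin n → ℝ) → ℝ) (q : ℝ × (Fin n → ℝ))
    (hg : DifferentiableAt ℝ g q) (l : Fin n) :
    HasDerivAt (fun w => g (q.1, Function.update q.2 l w))
      (fderiv ℝ g q (0, Pi.single l 1)) (q.2 l) := by
  have h1 : HasDerivAt (fun w : ℝ => (q.1, Function.update q.2 l w))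
      ((0 : ℝ), (Pi.single l 1 : Fin n → ℝ)) (q.2 l) :=
    (hasDerivAt_const _ _).prodMk (hasDerivAt_update q.2 l (q.2 l))
  have h2 : HasFDerivAt g (fderiv ℝ g q) (q.1, Function.update q.2 l (q.2 l)) := by
    simpa using hg.hasFDerivAt
  exact h2.comp_hasDerivAt (q.2 l) h1

theorem fderiv_sum_aux {n : ℕ} (L : ℝ × (Fin n → ℝ) →L[ℝ] ℝ) (v : Fin n → ℝ) :
    L (0, v) = ∑ l, L (0, Pi.single l 1) * v l := by
  have h : ((0 : ℝ), v) = ∑ l, v l • ((0 : ℝ), (Pi.single l 1 : Fin n → ℝ)) := by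
    refine Prod.ext ?_ ?_
    · simp [Prod.fst_sum]
    · ext i
      simp [Prod.snd_sum, Finset.sum_apply, Pi.single_apply]
  rw [h, map_sum]
  exact Finset.sum_congr rfl fun l _ => by rw [map_smul, smul_eq_mul, mul_comm]

/-- Let `n ≥ 1`, let `U ⊆ ℝ^{1+n}` be open with coordinates `(x, z)`, and
let `A : U → Mₙ(ℝ)` be a `C^∞` matrix-valued map with entries `a_{ij}`. For `q ∈ U` set
`αᵢ(q) = Σₖ a_{ki}(q)·a_{kn}(q)` and `β(q) = √(Σₖ a_{kn}(q)²)` (where `n` stands for the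
last index). Let `q₀ ∈ U` with `β(q₀) ≠ 0`, and let `(x, z, pₓ, p_z)` be a `C^∞` solution
on an open interval `J ∋ 0` of the Hamiltonian system
`x' = pₓ`, `z' = (AᵀA)(x,z)·p_z`, `pₓ' = −½⟨p_z, ∂ₓ(AᵀA)·p_z⟩`,
`(p_z)ⱼ' = −½⟨p_z, ∂_{zⱼ}(AᵀA)·p_z⟩`, with `(x(0),z(0)) = q₀`, `pₓ(0) = 0` and
`p_z(0) = eₙ/β(q₀)`. Then for every `i = 1,…,n` the second derivative `zᵢ''(0)` equals
`(1/β(q₀)²)·[ Σₗ ∂_{zₗ}αᵢ(q₀)·αₗ(q₀) − ½·Σ_{j,k} a_{ki}(q₀)·a_{kj}(q₀)·∂_{zⱼ}(β²)(q₀) ]`. -/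
theorem statement10 (n : ℕ) (hn : 1 ≤ n)
    (U : Set (ℝ × (Fin n → ℝ))) (hUopen : IsOpen U)
    (a : ℝ → (Fin n → ℝ) → Matrix (Fin n) (Fin n) ℝ)
    (ha : ∀ i j, ContDiffOn ℝ (⊤ : ℕ∞) (fun q : ℝ × (Fin n → ℝ) => a q.1 q.2 i j) U)
    (last : Fin n) (hlast : (last : ℕ) = n - 1)
    (α : ℝ → (Fin n → ℝ) → Fin n → ℝ)
    (hα : ∀ x z i, α x z i = ∑ k, a x z k i * a x z k last)
    (β : ℝ → (Fin n → ℝ) → ℝ)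
    (hβ : ∀ x z, β x z = Real.sqrt (∑ k, (a x z k last) ^ 2))
    (q₀ : ℝ × (Fin n → ℝ)) (hq₀U : q₀ ∈ U) (hβq₀ : β q₀.1 q₀.2 ≠ 0)
    (M : ℝ → (Fin n → ℝ) → Matrix (Fin n) (Fin n) ℝ)
    (hM : ∀ x z, M x z = (a x z)ᵀ * a x z)
    (J : Set ℝ) (hJopen : IsOpen J) (hJconn : J.OrdConnected) (h0J : (0 : ℝ) ∈ J)
    (x : ℝ → ℝ) (z : ℝ → Fin n → ℝ) (px : ℝ → ℝ) (pz : ℝ → Fin n → ℝ)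
    (hx : ContDiffOn ℝ (⊤ : ℕ∞) x J) (hz : ContDiffOn ℝ (⊤ : ℕ∞) z J)
    (hpx : ContDiffOn ℝ (⊤ : ℕ∞) px J) (hpz : ContDiffOn ℝ (⊤ : ℕ∞) pz J)
    (hmem : ∀ t ∈ J, (x t, z t) ∈ U)
    (hode₁ : ∀ t ∈ J, deriv x t = px t)
    (hode₂ : ∀ t ∈ J, ∀ i, deriv (fun s => z s i) t = (M (x t) (z t) *ᵥ pz t) i)
    (hode₃ : ∀ t ∈ J, deriv px t =
      -(1 / 2) * (pz t ⬝ᵥ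
        ((Matrix.of fun i j => deriv (fun w => M w (z t) i j) (x t)) *ᵥ pz t)))
    (hode₄ : ∀ t ∈ J, ∀ j, deriv (fun s => pz s j) t =
      -(1 / 2) * (pz t ⬝ᵥ
        ((Matrix.of fun i k =>
            deriv (fun w => M (x t) (Function.update (z t) j w) i k) (z t j)) *ᵥ pz t)))
    (hx0 : x 0 = q₀.1) (hz0 : z 0 = q₀.2) (hpx0 : px 0 = 0)
    (hpz0 : pz 0 = Pi.single last (1 / β q₀.1 q₀.2)) :
    ∀ i, deriv (fun t => deriv (fun s => z s i) t) 0 =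
      (1 / (β q₀.1 q₀.2) ^ 2) *
        ((∑ l, deriv (fun w => α q₀.1 (Function.update q₀.2 l w) i) (q₀.2 l)
            * α q₀.1 q₀.2 l)
          - (1 / 2) * ∑ j, ∑ k, a q₀.1 q₀.2 k i * a q₀.1 q₀.2 k j
              * deriv (fun w => (β q₀.1 (Function.update q₀.2 j w)) ^ 2) (q₀.2 j)) := by
  intro i
  have hg : ∀ i j, DifferentiableAt ℝ (fun q : ℝ × (Fin n → ℝ) => M q.1 q.2 i j) q₀ := by
    intro i j
    have ha' : ∀ i j, DifferentiableAt ℝ (fun q : ℝ × (Fin n → ℝ) => a q.1 q.2 i j) q₀ :=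
      fun i j => ((ha i j).contDiffAt (hUopen.mem_nhds hq₀U)).differentiableAt (by simp)
    simp only [hM, Matrix.mul_apply, Matrix.transpose_apply]
    exact DifferentiableAt.fun_sum fun k _ => (ha' k i).mul (ha' k j)
  have hMα : ∀ x z i, M x z i last = α x z i := by
    intro x z i
    simp [hM, hα, Matrix.mul_apply]
  have hMβ : ∀ x z, β x z ^ 2 = M x z last last := by
    intro x z
    rw [hβ, Real.sq_sqrt (Finset.sum_nonneg fun k _ => sq_nonneg _), hM]
    simp [Matrix.mul_apply, sq]
  have hJ := hJopen.mem_nhds h0J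
  have hxd : HasDerivAt x 0 0 := by
    have := ((hx.contDiffAt hJ).differentiableAt (by simp)).hasDerivAt
    rwa [hode₁ 0 h0J, hpx0] at this
  have hzd0 : ∀ i, HasDerivAt (fun s => z s i) (α q₀.1 q₀.2 i / β q₀.1 q₀.2) 0 := by
    intro i
    have h1 := (differentiableAt_pi.1 ((hz.contDiffAt hJ).differentiableAt (by simp)) i).hasDerivAt
    rw [hode₂ 0 h0J, hpz0, hx0, hz0] at h1
    simpa [hMα, div_eq_mul_inv, mul_comm] using h1
  have hzd : HasDerivAt z (fun i => α q₀.1 q₀.2 i / β q₀.1 q₀.2) 0 := hasDerivAt_pi.2 hzd0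
  have hpd : ∀ j, HasDerivAt (fun s => pz s j)
      (-(1 / 2) * (deriv (fun w => (β q₀.1 (Function.update q₀.2 j w)) ^ 2) (q₀.2 j)
        / β q₀.1 q₀.2 ^ 2)) 0 := by
    intro j
    have h1 := (differentiableAt_pi.1
      ((hpz.contDiffAt hJ).differentiableAt (by simp)) j).hasDerivAt
    rw [hode₄ 0 h0J, hpz0, hx0, hz0] at h1
    have h5 : (fun w => (β q₀.1 (Function.update q₀.2 j w)) ^ 2) =
        fun w => M q₀.1 (Function.update q₀.2 j w) last last := funext fun w => hMβ _ _
    rw [h5]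
    refine h1.congr_deriv ?_
    simp only [single_dotProduct, Matrix.mulVec_single, Pi.smul_apply, Matrix.col_apply,
      Matrix.of_apply, MulOpposite.smul_eq_mul_unop, MulOpposite.unop_op]
    ring
  have hMd : ∀ j, HasDerivAt (fun t => M (x t) (z t) i j)
      (∑ l, deriv (fun w => M q₀.1 (Function.update q₀.2 l w) i j) (q₀.2 l)
        * (α q₀.1 q₀.2 l / β q₀.1 q₀.2)) 0 := by
    intro j
    have h2 : HasFDerivAt (fun q : ℝ × (Fin n → ℝ) => M q.1 q.2 i j)
        (fderiv ℝ (fun q : ℝ × (Fin n → ℝ) => M q.1 q.2 i j) q₀) (x 0, z 0) := by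
      rw [hx0, hz0]; exact (hg i j).hasFDerivAt
    have h3 := h2.comp_hasDerivAt (0 : ℝ) (hxd.prodMk hzd)
    rw [fderiv_sum_aux] at h3
    have h4 : ∀ l, deriv (fun w => M q₀.1 (Function.update q₀.2 l w) i j) (q₀.2 l) = _ :=
      fun l => (hasDerivAt_update_aux _ q₀ (hg i j) l).deriv
    simp only [h4]
    exact h3
  have hev : (fun t => deriv (fun s => z s i) t) =ᶠ[nhds 0]
      fun t => ∑ j, M (x t) (z t) i j * pz t j := by
    filter_upwards [hJ] with t ht
    rw [hode₂ t ht]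
    rfl
  rw [hev.deriv_eq, (HasDerivAt.fun_sum fun j _ => (hMd j).fun_mul (hpd j)).deriv, hpz0, hx0, hz0,
    Finset.sum_add_distrib, mul_sub]
  rw [sub_eq_add_neg]
  congr 1
  · rw [Finset.sum_eq_single last]
    · simp only [hMα, Pi.single_eq_same, Finset.sum_mul, Finset.mul_sum]
      refine Finset.sum_congr rfl fun l _ => ?_
      field_simp
    · intro b _ hb
      simp [Pi.single_eq_of_ne hb]
    · simp
  · simp only [Finset.mul_sum, ← Finset.sum_neg_distrib]
    refine Finset.sum_congr rfl fun j _ => ?_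
    rw [hM, Matrix.mul_apply, Finset.sum_mul]
    refine Finset.sum_congr rfl fun k _ => ?_
    rw [Matrix.transpose_apply]
    ring
end

section
/- Let l ≥ 1 be an integer, let h : ℝ → ℝ be a C^∞ function with h(0) ≠ 0, and define β(x) = x^l·h(x). Then x²·( (β'(x))² + β(x)·β''(x) ) / β(x)² → 2l² − l as x → 0 along nonzero x, and moreover x·β'(x)/β(x) → l as x → 0 along nonzero x. In particular, since 2l² − l > 0, the function x ↦ ( (β'(x))² + β(x)·β''(x) ) / (2 β(x)²) tends to +∞ as x → 0 along nonzero x. -/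
open Filter Topology

/-- Let `l ≥ 1` be an integer, let `h : ℝ → ℝ` be `C^∞` with `h 0 ≠ 0`,
and define `β x = x^l·h x`. Then `x²·((β'(x))² + β(x)·β''(x))/β(x)² → 2l² − l` as `x → 0`
along nonzero `x`, and moreover `x·β'(x)/β(x) → l` as `x → 0` along nonzero `x`. In
particular, since `2l² − l > 0`, the function `x ↦ ((β'(x))² + β(x)·β''(x))/(2β(x)²)`
tends to `+∞` as `x → 0` along nonzero `x`. -/
theorem statement11 (l : ℕ) (hl : 1 ≤ l) (h : ℝ → ℝ) (hh : ContDiff ℝ (⊤ : ℕ∞) h)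
    (hh0 : h 0 ≠ 0) (β : ℝ → ℝ) (hβ : ∀ x, β x = x ^ l * h x) :
    Tendsto
        (fun x : ℝ => x ^ 2 * ((deriv β x) ^ 2 + β x * deriv (deriv β) x) / (β x) ^ 2)
        (𝓝[≠] (0 : ℝ)) (𝓝 (2 * (l : ℝ) ^ 2 - l)) ∧
      Tendsto (fun x : ℝ => x * deriv β x / β x) (𝓝[≠] (0 : ℝ)) (𝓝 (l : ℝ)) ∧
      Tendsto
        (fun x : ℝ => ((deriv β x) ^ 2 + β x * deriv (deriv β) x) / (2 * (β x) ^ 2))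
        (𝓝[≠] (0 : ℝ)) atTop := by
  obtain ⟨k, rfl⟩ : ∃ k, l = k + 1 := ⟨l - 1, by omega⟩
  have hd0 : Differentiable ℝ h := hh.differentiable (by simp)
  have hc1 : ContDiff ℝ (⊤ : ℕ∞) (deriv h) := (contDiff_infty_iff_deriv.1 hh).2
  have hd1 : Differentiable ℝ (deriv h) := hc1.differentiable (by simp)
  have hc2 : ContDiff ℝ (⊤ : ℕ∞) (deriv (deriv h)) := (contDiff_infty_iff_deriv.1 hc1).2
  have k0 : Continuous h := hh.continuous
  have k1 : Continuous (deriv h) := hc1.continuous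
  have k2 : Continuous (deriv (deriv h)) := hc2.continuous
  have eβ : β = fun x => x ^ (k + 1) * h x := funext hβ
  have e1 : deriv β = fun x => ((k : ℝ) + 1) * (x ^ k * h x) + x ^ (k + 1) * deriv h x := by
    funext x
    have := ((hasDerivAt_pow (k + 1) x).mul (hd0 x).hasDerivAt).deriv
    rw [eβ]
    refine Eq.trans this ?_
    push_cast
    ring
  have e2 : ∀ x, x * deriv (deriv β) x =
      ((k : ℝ) + 1) * (k * x ^ k * h x + x * (x ^ k * deriv h x)) +
      x * (((k : ℝ) + 1) * x ^ k * deriv h x + x ^ (k + 1) * deriv (deriv h) x) := by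
    intro x
    have := ((((hasDerivAt_pow k x).mul (hd0 x).hasDerivAt).const_mul ((k : ℝ) + 1)).add
      ((hasDerivAt_pow (k + 1) x).mul (hd1 x).hasDerivAt)).deriv
    have h2 : deriv (deriv β) x =
        ((k : ℝ) + 1) * (k * x ^ (k - 1) * h x + x ^ k * deriv h x) +
        (((k + 1 : ℕ) : ℝ) * x ^ (k + 1 - 1) * deriv h x + x ^ (k + 1) * deriv (deriv h) x) := by
      rw [e1]
      exact this
    rw [h2]
    push_cast
    rcases k with _ | m
    · simp
      ring
    · simp only [Nat.add_sub_cancel]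
      push_cast
      ring
  have hne : ∀ᶠ x in 𝓝[≠] (0 : ℝ), h x ≠ 0 :=
    (k0.continuousAt.eventually_ne hh0).filter_mono nhdsWithin_le_nhds
  have hx0 : ∀ᶠ x in 𝓝[≠] (0 : ℝ), x ≠ 0 := eventually_mem_nhdsWithin
  have T1 : Tendsto
        (fun x : ℝ => x ^ 2 * ((deriv β x) ^ 2 + β x * deriv (deriv β) x) / (β x) ^ 2)
        (𝓝[≠] (0 : ℝ)) (𝓝 (2 * ((k + 1 : ℕ) : ℝ) ^ 2 - (k + 1 : ℕ))) := by
    have hc : ContinuousAt (fun x : ℝ => ((((k : ℝ) + 1) * h x + x * deriv h x) ^ 2 +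
        h x * (((k : ℝ) + 1) * k * h x + 2 * ((k : ℝ) + 1) * x * deriv h x +
          x ^ 2 * deriv (deriv h) x)) / h x ^ 2) 0 := by
      apply ContinuousAt.div
      · exact Continuous.continuousAt (by fun_prop)
      · exact Continuous.continuousAt (by fun_prop)
      · exact pow_ne_zero 2 hh0
    have ht := hc.tendsto.mono_left (nhdsWithin_le_nhds (s := {0}ᶜ))
    refine Tendsto.congr' ?_ (ht.trans (le_of_eq ?_))
    · filter_upwards [hne, hx0] with x hx hx'
      have hb : β x ^ 2 ≠ 0 := by
        rw [hβ]
        positivity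
      have e : x ^ 2 * ((deriv β x) ^ 2 + β x * deriv (deriv β) x) =
        (x * deriv β x) ^ 2 + β x * (x * (x * deriv (deriv β) x)) := by ring
      rw [div_eq_div_iff (pow_ne_zero 2 hx) hb, e, e2, e1, hβ]
      ring
    · congr 1
      push_cast
      field_simp
      ring
  refine ⟨T1, ?_, ?_⟩
  · have hc : ContinuousAt (fun x : ℝ => (((k : ℝ) + 1) * h x + x * deriv h x) / h x) 0 := by
      apply ContinuousAt.div
      · exact Continuous.continuousAt (by fun_prop)
      · exact Continuous.continuousAt (by fun_prop)
      · exact hh0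
    have ht := hc.tendsto.mono_left (nhdsWithin_le_nhds (s := {0}ᶜ))
    refine Tendsto.congr' ?_ (ht.trans (le_of_eq ?_))
    · filter_upwards [hne, hx0] with x hx hx'
      have hb : β x ≠ 0 := by
        rw [hβ]
        positivity
      rw [div_eq_div_iff hx hb, e1, hβ]
      ring
    · congr 1
      push_cast
      field_simp
      ring
  · have hpos : (0 : ℝ) < 2 * ((k + 1 : ℕ) : ℝ) ^ 2 - (k + 1 : ℕ) := by
      push_cast
      have : (0 : ℝ) ≤ k := Nat.cast_nonneg k
      nlinarith
    have hi : Tendsto (fun x : ℝ => (2 * x ^ 2)⁻¹) (𝓝[≠] (0 : ℝ)) atTop := by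
      apply Tendsto.inv_tendsto_nhdsGT_zero
      refine tendsto_nhdsWithin_iff.2 ⟨?_, ?_⟩
      · have : Continuous (fun x : ℝ => 2 * x ^ 2) := by fun_prop
        have := (this.tendsto 0).mono_left (nhdsWithin_le_nhds (s := {0}ᶜ))
        simpa using this
      · filter_upwards [hx0] with x hx
        show (0 : ℝ) < 2 * x ^ 2
        positivity
    refine Tendsto.congr' ?_ (T1.pos_mul_atTop hpos hi)
    filter_upwards [hne, hx0] with x hx hx'
    have hb : β x ≠ 0 := by
      rw [hβ]
      positivity
    field_simp
end

section
/- Let l ≥ 1 be an integer, let h : ℝ → ℝ be a C^∞ function with h(0) ≠ 0, and set β(x) = x^l·h(x). Let C₁, C₂ ≥ 0 and let u be a real-valued function defined for small nonzero x satisfying |u(x)| ≤ C₁ + C₂·|β'(x)/β(x)|. Then the function x ↦ ( (β'(x))² + β(x)·β''(x) ) / (2 β(x)²) + u(x) tends to +∞ as x → 0 along nonzero x. In particular, for every K ∈ ℝ there exists δ > 0 such that this function is strictly greater than −K for all 0 < |x| < δ. -/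
open Filter Topology

/-- Let `l ≥ 1` be an integer, let `h : ℝ → ℝ` be `C^∞` with `h 0 ≠ 0`,
and set `β x = x^l·h x`. Let `C₁, C₂ ≥ 0` and let `u` be a real-valued function defined for
small nonzero `x` satisfying `|u x| ≤ C₁ + C₂·|β'(x)/β(x)|`. Then
`x ↦ ((β'(x))² + β(x)·β''(x))/(2β(x)²) + u x` tends to `+∞` as `x → 0` along nonzero `x`.
In particular, for every `K ∈ ℝ` there exists `δ > 0` such that this function is strictly
greater than `−K` for all `0 < |x| < δ`. -/
theorem statement12 (l : ℕ) (hl : 1 ≤ l) (h : ℝ → ℝ) (hh : ContDiff ℝ (⊤ : ℕ∞) h)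
    (hh0 : h 0 ≠ 0) (β : ℝ → ℝ) (hβ : ∀ x, β x = x ^ l * h x)
    (C₁ C₂ : ℝ) (hC₁ : 0 ≤ C₁) (hC₂ : 0 ≤ C₂)
    (ρ : ℝ) (hρ : 0 < ρ) (u : ℝ → ℝ)
    (hu : ∀ x : ℝ, 0 < |x| → |x| < ρ → |u x| ≤ C₁ + C₂ * |deriv β x / β x|) :
    Tendsto
        (fun x : ℝ =>
          ((deriv β x) ^ 2 + β x * deriv (deriv β) x) / (2 * (β x) ^ 2) + u x)
        (𝓝[≠] (0 : ℝ)) atTop ∧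
      ∀ K : ℝ, ∃ δ > (0 : ℝ), ∀ x : ℝ, 0 < |x| → |x| < δ →
        ((deriv β x) ^ 2 + β x * deriv (deriv β) x) / (2 * (β x) ^ 2) + u x > -K := by
  obtain ⟨m, rfl⟩ : ∃ m, l = m + 1 := ⟨l - 1, by omega⟩
  have hh1 : ContDiff ℝ (⊤ : ℕ∞) (deriv h) := ContDiff.iterate_deriv 1 hh
  have hh2 : ContDiff ℝ (⊤ : ℕ∞) (deriv (deriv h)) := ContDiff.iterate_deriv 1 hh1
  have d0 : ∀ x, HasDerivAt h (deriv h x) x := fun x =>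
    ((hh.differentiable (by simp)) x).hasDerivAt
  have d1 : ∀ x, HasDerivAt (deriv h) (deriv (deriv h) x) x := fun x =>
    ((hh1.differentiable (by simp)) x).hasDerivAt
  have c0 : Continuous h := hh.continuous
  have c1 : Continuous (deriv h) := hh1.continuous
  have c2 : Continuous (deriv (deriv h)) := hh2.continuous
  obtain ⟨g, hg⟩ : ∃ g : ℝ → ℝ, g = fun x => ((m : ℝ) + 1) * h x + x * deriv h x := ⟨_, rfl⟩
  obtain ⟨g', hg'⟩ : ∃ g' : ℝ → ℝ, g' = fun x =>
    ((m : ℝ) + 1) * deriv h x + (deriv h x + x * deriv (deriv h) x) := ⟨_, rfl⟩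
  have dg : ∀ x, HasDerivAt g (g' x) x := by
    intro x
    rw [hg, hg']
    have := ((d0 x).const_mul ((m : ℝ) + 1)).add ((hasDerivAt_id x).mul (d1 x))
    refine this.congr_deriv ?_
    simp
  have cg : Continuous g := by rw [hg]; fun_prop
  have cg' : Continuous g' := by rw [hg']; fun_prop
  have hβ1 : deriv β = fun x => x ^ m * g x := by
    funext x
    have hb : β = fun x => x ^ (m + 1) * h x := funext hβ
    have := (hasDerivAt_pow (m + 1) x).mul (d0 x)
    rw [hb]
    refine (this.deriv).trans ?_
    rw [hg]
    simp
    ring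
  have hβ2 : ∀ x, x * deriv (deriv β) x = x ^ m * (m * g x + x * g' x) := by
    intro x
    have := (hasDerivAt_pow m x).mul (dg x)
    rw [hβ1]
    have e := this.deriv
    have e' : deriv (fun x => x ^ m * g x) x = m * x ^ (m - 1) * g x + x ^ m * g' x := e
    rw [e']
    rcases m with _ | k
    · simp
    · simp; ring
  have hlim : Tendsto (fun x : ℝ => ((g x / h x) ^ 2 + (m * g x + x * g' x) / h x) / 2
      - C₁ * x ^ 2 - C₂ * (|g x / h x| * |x|)) (𝓝[≠] 0)
      (𝓝 (((m + 1 : ℝ) ^ 2 + m * (m + 1)) / 2)) := by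
    have : ContinuousAt (fun x : ℝ => ((g x / h x) ^ 2 + (m * g x + x * g' x) / h x) / 2
      - C₁ * x ^ 2 - C₂ * (|g x / h x| * |x|)) 0 := by
      have a0 := c0.continuousAt (x := 0)
      have a1 := cg.continuousAt (x := 0)
      have a2 := cg'.continuousAt (x := 0)
      fun_prop (disch := assumption)
    have t := this.tendsto.mono_left (nhdsWithin_le_nhds (s := {0}ᶜ))
    have hg0 : g 0 = (m + 1) * h 0 := by simp [hg]
    convert t using 2
    rw [hg0]
    field_simp
    simp
    ring
  have hinv : Tendsto (fun x : ℝ => (x ^ 2)⁻¹) (𝓝[≠] 0) atTop := by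
    apply Tendsto.inv_tendsto_nhdsGT_zero
    refine tendsto_nhdsWithin_iff.2 ⟨?_, ?_⟩
    · have : ContinuousAt (fun x : ℝ => x ^ 2) 0 := by fun_prop
      simpa using this.tendsto.mono_left (nhdsWithin_le_nhds (s := {0}ᶜ))
    · filter_upwards [self_mem_nhdsWithin] with x hx
      have : x ≠ 0 := hx
      show 0 < x ^ 2
      positivity
  have main := hlim.pos_mul_atTop (by positivity) hinv
  have hnz : ∀ᶠ x in 𝓝[≠] (0 : ℝ), h x ≠ 0 :=
    nhdsWithin_le_nhds ((c0.continuousAt (x := 0)).eventually_ne hh0)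
  have hball : ∀ᶠ x in 𝓝[≠] (0 : ℝ), |x| < ρ := by
    refine nhdsWithin_le_nhds ?_
    have := Metric.ball_mem_nhds (0 : ℝ) hρ
    filter_upwards [this] with x hx
    simpa using hx
  have T : Tendsto
        (fun x : ℝ =>
          ((deriv β x) ^ 2 + β x * deriv (deriv β) x) / (2 * (β x) ^ 2) + u x)
        (𝓝[≠] (0 : ℝ)) atTop := by
    refine tendsto_atTop_mono' _ ?_ main
    filter_upwards [hnz, hball, self_mem_nhdsWithin] with x hx hxρ hx0
    have hx0 : x ≠ 0 := hx0
    have hux := hu x (abs_pos.2 hx0) hxρ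
    have e1 : deriv β x / β x = (g x / h x) / x := by
      rw [hβ1, hβ]; field_simp; ring
    have e2 : deriv (deriv β) x = x ^ m * (m * g x + x * g' x) / x := by
      rw [← hβ2]; field_simp
    have e3 : ((deriv β x) ^ 2 + β x * deriv (deriv β) x) / (2 * (β x) ^ 2)
        = ((g x / h x) ^ 2 + (m * g x + x * g' x) / h x) / 2 * (x ^ 2)⁻¹ := by
      rw [e2, hβ1, hβ]; field_simp; ring
    rw [e1, abs_div] at hux
    have e4 : |g x / h x| * |x| * (x ^ 2)⁻¹ = |g x / h x| / |x| := by
      rw [← sq_abs x]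
      have := abs_pos.2 hx0
      field_simp
    have e5 : x ^ 2 * (x ^ 2)⁻¹ = 1 := by field_simp
    rw [e3, sub_mul, sub_mul, mul_assoc C₁, mul_assoc C₂, e4, e5]
    have := neg_abs_le (u x)
    linarith
  refine ⟨T, fun K => ?_⟩
  have ev := T.eventually_gt_atTop (-K)
  rw [eventually_nhdsWithin_iff, Metric.eventually_nhds_iff] at ev
  obtain ⟨δ, hδ, H⟩ := ev
  refine ⟨δ, hδ, fun x hx hxδ => ?_⟩
  exact H (by simpa using hxδ) (abs_pos.1 hx)
end
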